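/- arXiv:2211.08178 — 2 statements merged into one kernel-verified Lean document; each statement's English description precedes it below -/
import Mathlib

section
/- Let G be a nontrivial finite group and p a prime. Then cod(χ) = |G : ker χ| / χ(1) is a power of p for every irreducible complex character χ of G if and only if G is a p-group. -/
open CategoryTheory Module

/-- The kernel of (the representation affording) a character, as a subgroup. -/
noncomputable def FDRep.charKer {G : Type} [Group G] (V : FDRep ℂ G) : Subgroup G :=
  MonoidHom.ker (Representation.asGroupHom V.ρ)

/-- The codegree `cod(χ) = |G : ker χ| / χ(1)` of the character of `V`. -/
noncomputable def FDRep.codegree {G : Type} [Group G] (V : FDRep ℂ G) : ℕ :=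
  (FDRep.charKer V).index / (finrank ℂ V)

open scoped Classical in
/-- The character of `G` induced from the linear character `lam` of the subgroup `H`:
`χ(g) = |H|⁻¹ ∑_{x ∈ G} λ°(x⁻¹ g x)`, where `λ°` is `lam` extended by zero. -/
noncomputable def inducedLinearChar {G : Type} [Group G] [Fintype G]
    (H : Subgroup G) (lam : H →* ℂˣ) : G → ℂ :=
  fun g => (Nat.card H : ℂ)⁻¹ *
    ∑ x : G, if h : x⁻¹ * g * x ∈ H then ((lam ⟨x⁻¹ * g * x, h⟩ : ℂˣ) : ℂ) else 0

/-- A class function is monomial if it is induced from a linear character of a subgroup. -/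
def IsMonomialChar {G : Type} [Group G] [Fintype G] (χ : G → ℂ) : Prop :=
  ∃ (H : Subgroup G) (lam : H →* ℂˣ), χ = inducedLinearChar H lam

/-- A group has a unique minimal normal subgroup. -/
def HasUniqueMinimalNormalSubgroup (H : Type*) [Group H] : Prop :=
  ∃! N : Subgroup H, N.Normal ∧ N ≠ ⊥ ∧
    ∀ K : Subgroup H, K.Normal → K ≠ ⊥ → K ≤ N → K = N

instance {G : Type} [Group G] (V : FDRep ℂ G) : (FDRep.charKer V).Normal :=
  MonoidHom.normal_ker _


theorem cod_isIntegral_trace {V : Type*} [AddCommGroup V] [Module ℂ V] [FiniteDimensional ℂ V]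
    (f : V →ₗ[ℂ] V) (n : ℕ) (hn : 0 < n) (hf : f ^ n = 1) : IsIntegral ℤ (LinearMap.trace ℂ V f) := by
  rw [LinearMap.trace_eq_matrix_trace ℂ (Module.finBasis ℂ V), Matrix.trace_eq_sum_roots_charpoly,
    LinearMap.charpoly_toMatrix]
  apply IsIntegral.multiset_sum
  intro x hx
  have h1 : Module.End.HasEigenvalue f x := by
    rw [Module.End.hasEigenvalue_iff_isRoot_charpoly]
    exact (Polynomial.mem_roots'.1 hx).2
  obtain ⟨v, hv⟩ := h1.exists_hasEigenvector
  have h2 : x ^ n = 1 := by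
    have := hv.pow_apply n
    rw [hf] at this
    have h3 : (x ^ n - 1) • v = 0 := by
      rw [sub_smul, ← this]; simp
    rcases smul_eq_zero.1 h3 with h | h
    · exact sub_eq_zero.1 h
    · exact absurd h hv.2
  apply IsIntegral.of_pow hn
  rw [h2]; exact isIntegral_one

theorem cod_finrank_dvd {Γ V : Type*} [Group Γ] [Finite Γ] [AddCommGroup V] [Module ℂ V]
    [FiniteDimensional ℂ V] [Nontrivial V] (ρ : Representation ℂ Γ V)
    (hs : ∀ f : V →ₗ[ℂ] V, (∀ g, f ∘ₗ ρ g = ρ g ∘ₗ f) → ∃ c : ℂ, f = c • LinearMap.id) :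
    finrank ℂ V ∣ Nat.card Γ := by
  classical
  have := Fintype.ofFinite Γ
  have hc0 : (Nat.card Γ : ℂ) ≠ 0 := by exact_mod_cast Nat.card_pos.ne'
  have : Invertible (Nat.card Γ : ℂ) := invertibleOfNonzero hc0
  have hfr : finrank ℂ (Representation.IntertwiningMap ρ ρ) = 1 := by
    rw [finrank_eq_one_iff']
    refine ⟨.id ρ, ?_, ?_⟩
    · intro h
      obtain ⟨v, hv⟩ := exists_ne (0 : V)
      apply hv
      have := congrArg (fun f => f.toLinearMap v) h
      simpa using this
    · intro w
      obtain ⟨c, hc⟩ := hs w.toLinearMap (fun g => w.2 g)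
      refine ⟨c, ?_⟩
      ext v
      have := congrArg (fun f => f v) hc
      simpa using this.symm
  have horth := Representation.card_inv_mul_sum_char_mul_char_eq_finrank ρ ρ
  rw [hfr] at horth
  have hsum : ∑ g : Γ, ρ.character g * ρ.character g⁻¹ = Nat.card Γ := by
    field_simp at horth
    simpa using horth
  have hint : ∀ g, IsIntegral ℤ (ρ.character g) := fun g =>
    cod_isIntegral_trace (ρ g) (Nat.card Γ) Nat.card_pos (by rw [← map_pow, pow_card_eq_one', map_one])
  let E : V →ₗ[ℂ] V := ∑ g : Γ, ρ.character g⁻¹ • ρ g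
  obtain ⟨c, hc⟩ := hs E (by
    intro h
    change E * ρ h = ρ h * E
    simp only [E, Finset.sum_mul, Finset.mul_sum]
    refine Fintype.sum_equiv (MulAut.conj h⁻¹).toEquiv _ _ ?_
    intro g
    have : ρ.character (h⁻¹ * g⁻¹ * h) = ρ.character g⁻¹ := by
      simpa using ρ.char_conj g⁻¹ h⁻¹
    simp [← map_mul, mul_assoc] at this ⊢
    rw [this])
  have htr : (Nat.card Γ : ℂ) = c * finrank ℂ V := by
    have := congrArg (LinearMap.trace ℂ V) hc
    simp only [E, map_sum, map_smul, smul_eq_mul, LinearMap.trace_id] at this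
    rw [← this, ← hsum]
    refine Finset.sum_congr rfl fun g _ => ?_
    rw [mul_comm]; rfl
  let O := integralClosure ℤ ℂ
  let φ : MonoidAlgebra O Γ →ₐ[O] Module.End ℂ V := MonoidAlgebra.lift O (Module.End ℂ V) Γ ρ
  let e : MonoidAlgebra O Γ := ∑ g : Γ, MonoidAlgebra.single g (⟨ρ.character g⁻¹, hint _⟩ : O)
  have hφ : φ e = algebraMap ℂ (Module.End ℂ V) c := by
    have : φ e = E := by
      simp only [e, E, φ, map_sum, MonoidAlgebra.lift_single]
      rfl
    rw [this, hc]; rfl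
  have he : IsIntegral O e := Algebra.IsIntegral.isIntegral e
  have hcO : IsIntegral O c := by
    have := he.map φ
    rw [hφ] at this
    exact (isIntegral_algebraMap_iff (FaithfulSMul.algebraMap_injective ℂ (Module.End ℂ V))).1 this
  have hcZ : IsIntegral ℤ c := isIntegral_trans (A := O) c hcO
  have hn0 : (finrank ℂ V : ℂ) ≠ 0 := by exact_mod_cast finrank_pos.ne'
  have hcq : c = algebraMap ℚ ℂ ((Nat.card Γ : ℚ) / finrank ℂ V) := by
    rw [map_div₀, map_natCast, map_natCast, htr]; field_simp
  rw [hcq, isIntegral_algebraMap_iff (FaithfulSMul.algebraMap_injective ℚ ℂ)] at hcZ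
  obtain ⟨z, hz⟩ := IsIntegrallyClosed.isIntegral_iff.1 hcZ
  have hn0' : (finrank ℂ V : ℚ) ≠ 0 := by exact_mod_cast finrank_pos.ne'
  have : (finrank ℂ V : ℤ) ∣ (Nat.card Γ : ℤ) := by
    refine ⟨z, ?_⟩
    rw [eq_div_iff hn0'] at hz
    have h : ((z * (finrank ℂ V : ℤ) : ℤ) : ℚ) = ((Nat.card Γ : ℤ) : ℚ) := by
      push_cast; simpa using hz
    have := Int.cast_injective h
    rw [← this, mul_comm]
  exact_mod_cast this

theorem cod_finrank_dvd_index {G : Type} [Group G] [Fintype G] (V : FDRep ℂ G) (hV : Simple V) :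
    finrank ℂ V ∣ (FDRep.charKer V).index := by
  classical
  have hc0 : (Nat.card G : ℂ) ≠ 0 := by exact_mod_cast Nat.card_pos.ne'
  have : Invertible (Nat.card G : ℂ) := invertibleOfNonzero hc0
  have h1 := (FDRep.simple_iff_char_is_norm_one V).1 hV
  have h2 := Representation.card_inv_mul_sum_char_mul_char_eq_finrank (G := G) V.ρ V.ρ
  have h3 : finrank ℂ (Representation.IntertwiningMap (G := G) V.ρ V.ρ) = 1 := by
    have : ∑ g : G, Representation.character (G := G) V.ρ g *
        Representation.character (G := G) V.ρ g⁻¹ = Nat.card G := h1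
    rw [this, inv_mul_cancel₀ hc0] at h2
    exact_mod_cast h2.symm
  have hnt : Nontrivial V := by
    by_contra h
    rw [not_nontrivial_iff_subsingleton] at h
    have : Subsingleton (Representation.IntertwiningMap (G := G) V.ρ V.ρ) :=
      ⟨fun a b => by ext v; exact Subsingleton.elim _ _⟩
    rw [finrank_zero_of_subsingleton] at h3
    omega
  let F := Representation.asGroupHom (G := G) V.ρ
  rw [FDRep.charKer, Subgroup.index_ker]
  let ρ' : Representation ℂ F.range V := (Units.coeHom _).comp F.range.subtype
  refine cod_finrank_dvd ρ' ?_
  intro f hf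
  have hid : Representation.IntertwiningMap.id (G := G) V.ρ ≠ 0 := by
    intro h
    obtain ⟨v, hv⟩ := exists_ne (0 : V)
    apply hv
    have := congrArg (fun f => f.toLinearMap v) h
    simpa using this
  obtain ⟨c, hc⟩ := (finrank_eq_one_iff_of_nonzero' _ hid).1 h3 ⟨f, fun g => hf ⟨F g, g, rfl⟩⟩
  refine ⟨c, ?_⟩
  ext v
  have := congrArg (fun f => f.toLinearMap v) hc
  simpa using this.symm

theorem cod_irreducible_of_isAtom {G U : Type} [Group G] [AddCommGroup U] [Module ℂ U]
    (ρ : Representation ℂ G U) (S : Subrepresentation ρ) (hS : IsAtom S) :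
    Representation.IsIrreducible S.toRepresentation := by
  have hne : S.toSubmodule ≠ ⊥ := fun h => hS.1 (Subrepresentation.toSubmodule_injective h)
  have hnt : Nontrivial S.toSubmodule := Submodule.nontrivial_iff_ne_bot.2 hne
  refine { exists_pair_ne := ⟨⊥, ⊤, ?_⟩, eq_bot_or_eq_top := ?_ }
  · intro h
    have : (⊥ : Submodule ℂ S.toSubmodule) = ⊤ := congrArg (·.toSubmodule) h
    exact bot_ne_top this
  · intro X
    let Y : Subrepresentation ρ := ⟨X.toSubmodule.map S.toSubmodule.subtype, by
      rintro g _ ⟨x, hx, rfl⟩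
      exact ⟨S.toRepresentation g x, X.apply_mem_toSubmodule g hx, rfl⟩⟩
    have hYS : Y ≤ S := by
      rintro _ ⟨x, hx, rfl⟩
      exact x.2
    rcases hS.le_iff.1 hYS with h | h
    · left
      apply Subrepresentation.toSubmodule_injective
      have h' : X.toSubmodule.map S.toSubmodule.subtype = ⊥ := congrArg (·.toSubmodule) h
      change X.toSubmodule = ⊥
      rw [eq_bot_iff]
      intro x hx
      have hx' : (x : U) ∈ X.toSubmodule.map S.toSubmodule.subtype := ⟨x, hx, rfl⟩
      rw [h', Submodule.mem_bot] at hx'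
      exact Subtype.ext hx'
    · right
      apply Subrepresentation.toSubmodule_injective
      have h' : X.toSubmodule.map S.toSubmodule.subtype = S.toSubmodule :=
        congrArg (·.toSubmodule) h
      change X.toSubmodule = ⊤
      rw [eq_top_iff]
      intro x _
      have hx : (x : U) ∈ X.toSubmodule.map S.toSubmodule.subtype := by rw [h']; exact x.2
      obtain ⟨y, hy, hyx⟩ := hx
      have : y = x := Subtype.ext hyx
      rwa [← this]

theorem cod_simple_of_irreducible {G U : Type} [Group G] [Fintype G] [AddCommGroup U] [Module ℂ U]
    [FiniteDimensional ℂ U] (ρ : Representation ℂ G U) (h : ρ.IsIrreducible) :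
    Simple (FDRep.of ρ) := by
  classical
  have hc0 : (Nat.card G : ℂ) ≠ 0 := by exact_mod_cast Nat.card_pos.ne'
  have : Invertible (Nat.card G : ℂ) := invertibleOfNonzero hc0
  rw [FDRep.simple_iff_char_is_norm_one]
  have h2 := Representation.card_inv_mul_sum_char_mul_char_eq_finrank ρ ρ
  rw [Representation.IsIrreducible.finrank_intertwiningMap_self] at h2
  change ∑ g : G, ρ.character g * ρ.character g⁻¹ = _
  field_simp at h2
  simpa using h2

theorem cod_dvd_finrank {G U : Type} [Group G] [Fintype G] [AddCommGroup U] [Module ℂ U]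
    [FiniteDimensional ℂ U] (ρ : Representation ℂ G U) (m : ℕ) (W : Subrepresentation ρ)
    (hW : ∀ S : Subrepresentation ρ, S ≤ W → IsAtom S → m ∣ finrank ℂ S.toSubmodule) :
    m ∣ finrank ℂ W.toSubmodule := by
  induction hn : finrank ℂ W.toSubmodule using Nat.strong_induction_on generalizing W with
  | _ n ih =>
  subst hn
  have hat : IsAtomic (Subrepresentation ρ) :=
    (OrderIso.isAtomic_iff Subrepresentation.subrepresentationSubmoduleOrderIso).2 inferInstance
  rcases eq_bot_or_exists_atom_le W with h | ⟨S, hS, hSW⟩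
  · have : W.toSubmodule = ⊥ := congrArg (·.toSubmodule) h
    rw [this]; simp
  · have : Representation.IsSemisimpleRepresentation ρ := inferInstance
    obtain ⟨T, hT⟩ := exists_isCompl S
    have hd : S.toSubmodule ⊓ (W ⊓ T).toSubmodule = ⊥ := by
      have h1 : S ⊓ T = ⊥ := hT.inf_eq_bot
      have h2 : S.toSubmodule ⊓ T.toSubmodule = ⊥ := congrArg (·.toSubmodule) h1
      rw [eq_bot_iff, ← h2]
      exact inf_le_inf_left _ inf_le_right
    have hs : S.toSubmodule ⊔ (W ⊓ T).toSubmodule = W.toSubmodule := by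
      have h1 : S ⊔ T = ⊤ := hT.sup_eq_top
      have h2 : S.toSubmodule ⊔ T.toSubmodule = ⊤ := congrArg (·.toSubmodule) h1
      have hle : S.toSubmodule ≤ W.toSubmodule := hSW
      rw [Subrepresentation.toSubmodule_inf, inf_comm, ← sup_inf_assoc_of_le _ hle, h2, top_inf_eq]
    have hr := Submodule.finrank_sup_add_finrank_inf_eq S.toSubmodule (W ⊓ T).toSubmodule
    rw [hd, hs, finrank_bot, add_zero] at hr
    have hpos : 0 < finrank ℂ S.toSubmodule := by
      have hne : S.toSubmodule ≠ ⊥ := fun h => hS.1 (Subrepresentation.toSubmodule_injective h)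
      have : Nontrivial S.toSubmodule := Submodule.nontrivial_iff_ne_bot.2 hne
      exact finrank_pos
    rw [hr]
    refine dvd_add (hW S hSW hS) (ih _ (by omega) (W ⊓ T) ?_ rfl)
    intro S' h1 h2
    exact hW S' (h1.trans inf_le_left) h2

/-- The permutation representation on functions on `G ⧸ M`. -/
def codPermRep {G : Type} [Group G] (M : Subgroup G) : Representation ℂ G (G ⧸ M → ℂ) where
  toFun g := { toFun := fun f x => f (g⁻¹ • x), map_add' := fun _ _ => rfl,
               map_smul' := fun _ _ => rfl }
  map_one' := by ext; simp
  map_mul' g h := by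
    refine LinearMap.ext fun f => funext fun x => ?_
    simp [mul_smul]

theorem codPermRep_apply {G : Type} [Group G] (M : Subgroup G) (g : G) (f : G ⧸ M → ℂ) (x : G ⧸ M) :
    codPermRep M g f x = f (g⁻¹ • x) := rfl

open scoped Classical in
/-- Summation over the fibres of `G ⧸ M → G ⧸ N`. -/
noncomputable def codFibSum {G : Type} [Group G] [Fintype G] {M N : Subgroup G} (h : M ≤ N) :
    (G ⧸ M → ℂ) →ₗ[ℂ] (G ⧸ N → ℂ) where
  toFun f y := ∑ x : G ⧸ M, if Subgroup.quotientMapOfLE h x = y then f x else 0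
  map_add' f f' := by
    funext y
    simp only [Pi.add_apply, ← Finset.sum_add_distrib]
    refine Finset.sum_congr rfl fun x _ => ?_
    split_ifs <;> simp
  map_smul' c f := by
    funext y
    simp only [Pi.smul_apply, Finset.smul_sum, RingHom.id_apply]
    refine Finset.sum_congr rfl fun x _ => ?_
    split_ifs <;> simp

open scoped Classical in
theorem codFibSum_apply {G : Type} [Group G] [Fintype G] {M N : Subgroup G} (h : M ≤ N)
    (f : G ⧸ M → ℂ) (y : G ⧸ N) : codFibSum h f y =
      ∑ x : G ⧸ M, if Subgroup.quotientMapOfLE h x = y then f x else 0 := rfl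

theorem codFibSum_surjective {G : Type} [Group G] [Fintype G] {M N : Subgroup G} (h : M ≤ N) :
    Function.Surjective (codFibSum h) := by
  classical
  intro k
  have hπ : Function.Surjective (Subgroup.quotientMapOfLE h) := by
    intro y
    induction y using QuotientGroup.induction_on with
    | H g => exact ⟨(g : G ⧸ M), rfl⟩
  let s := Function.surjInv hπ
  have hs : ∀ y, Subgroup.quotientMapOfLE h (s y) = y := Function.surjInv_eq hπ
  refine ⟨fun x => if s (Subgroup.quotientMapOfLE h x) = x then
    k (Subgroup.quotientMapOfLE h x) else 0, ?_⟩
  funext y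
  rw [codFibSum_apply, Finset.sum_eq_single (s y)]
  · simp [hs]
  · intro x _ hx
    split_ifs with h1 h2
    · exact absurd (by rw [← h1, h2]) hx
    · rfl
    · rfl
  · simp

theorem cod_quotientMap_smul {G : Type} [Group G] {M N : Subgroup G} (h : M ≤ N) (g : G)
    (x : G ⧸ M) : Subgroup.quotientMapOfLE h (g • x) = g • Subgroup.quotientMapOfLE h x := by
  induction x using QuotientGroup.induction_on with
  | H a => rfl

theorem codFibSum_rep {G : Type} [Group G] [Fintype G] {M N : Subgroup G} (h : M ≤ N) (g : G)
    (f : G ⧸ M → ℂ) (y : G ⧸ N) :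
    codFibSum h (codPermRep M g f) y = codFibSum h f (g⁻¹ • y) := by
  classical
  rw [codFibSum_apply, codFibSum_apply]
  refine Fintype.sum_equiv (MulAction.toPerm g⁻¹) _ _ fun x => ?_
  simp only [MulAction.toPerm_apply, cod_quotientMap_smul, codPermRep_apply]
  simp

/-- The kernel of the fibre sum map, as a subrepresentation. -/
noncomputable def codKerRep {G : Type} [Group G] [Fintype G] {M N : Subgroup G} (h : M ≤ N) :
    Subrepresentation (codPermRep M) where
  toSubmodule := LinearMap.ker (codFibSum h)
  apply_mem_toSubmodule g f hf := by
    rw [LinearMap.mem_ker] at hf ⊢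
    funext y
    rw [codFibSum_rep, hf]; rfl

theorem finrank_codKerRep {G : Type} [Group G] [Fintype G] {M N : Subgroup G} (h : M ≤ N) :
    N.index + finrank ℂ (codKerRep h).toSubmodule = M.index := by
  classical
  have := LinearMap.finrank_range_add_finrank_ker (codFibSum h)
  rw [LinearMap.range_eq_top.2 (codFibSum_surjective h), finrank_top, finrank_fintype_fun_eq_card,
    finrank_fintype_fun_eq_card, Fintype.card_eq_nat_card, Fintype.card_eq_nat_card] at this
  exact this

theorem cod_atom_ker {G : Type} [Group G] [Fintype G] {M N : Subgroup G} (hM : M.Normal)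
    (h : M ≤ N) (hmin : ∀ L : Subgroup G, L.Normal → M < L → N ≤ L)
    (S : Subrepresentation (codPermRep M)) (hSW : S ≤ codKerRep h) (hS : IsAtom S) :
    FDRep.charKer (FDRep.of S.toRepresentation) = M := by
  classical
  set K := FDRep.charKer (FDRep.of S.toRepresentation) with hK
  have hmem : ∀ g, g ∈ K ↔ ∀ f ∈ S.toSubmodule, codPermRep M g f = f := by
    intro g
    rw [hK, FDRep.charKer, MonoidHom.mem_ker, Units.ext_iff, Representation.asGroupHom_apply]
    rw [FDRep.of_ρ']
    constructor
    · intro h1 f hf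
      exact congrArg Subtype.val (congrArg (fun F => F ⟨f, hf⟩) h1)
    · intro h1
      refine LinearMap.ext fun f => Subtype.ext ?_
      exact h1 f.1 f.2
  have hKn : K.Normal := inferInstance
  have hMK : M ≤ K := by
    intro g hg
    rw [hmem]
    intro f _
    funext x
    rw [codPermRep_apply]
    congr 1
    induction x using QuotientGroup.induction_on with
    | H a =>
      change ((g⁻¹ * a : G) : G ⧸ M) = (a : G ⧸ M)
      rw [QuotientGroup.eq]
      have := hM.conj_mem g hg a⁻¹
      simpa [mul_assoc] using this
  by_contra hne
  have hNK : N ≤ K := hmin K hKn (lt_of_le_of_ne hMK (Ne.symm hne))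
  apply hS.1
  apply Subrepresentation.toSubmodule_injective
  change S.toSubmodule = ⊥
  rw [eq_bot_iff]
  intro f hf
  have hf0 : codFibSum h f = 0 := hSW hf
  rw [Submodule.mem_bot]
  funext x
  have h0 := congrFun hf0 (Subgroup.quotientMapOfLE h x)
  rw [codFibSum_apply] at h0
  have hcst : ∀ y, Subgroup.quotientMapOfLE h y = Subgroup.quotientMapOfLE h x → f y = f x := by
    intro y
    induction x using QuotientGroup.induction_on with
    | H a =>
    induction y using QuotientGroup.induction_on with
    | H b =>
    intro hy
    have hab : a⁻¹ * b ∈ N := QuotientGroup.eq.1 (Eq.symm hy)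
    have hk : (b * a⁻¹)⁻¹ ∈ K := by
      apply K.inv_mem
      have := hKn.conj_mem _ (hNK hab) a
      simpa [mul_assoc] using this
    have := congrFun ((hmem _).1 hk f hf) (a : G ⧸ M)
    rw [codPermRep_apply, inv_inv] at this
    rw [← this]
    congr 1
    change (b : G ⧸ M) = ((b * a⁻¹ * a : G) : G ⧸ M)
    simp
  have h1 : ∑ y : G ⧸ M, (if Subgroup.quotientMapOfLE h y = Subgroup.quotientMapOfLE h x
      then f y else 0) = ∑ y : G ⧸ M, if Subgroup.quotientMapOfLE h y =
        Subgroup.quotientMapOfLE h x then f x else 0 := by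
    refine Finset.sum_congr rfl fun y _ => ?_
    split_ifs with hy
    · exact hcst y hy
    · rfl
  rw [h1, ← Finset.sum_filter, Finset.sum_const, nsmul_eq_mul] at h0
  rcases mul_eq_zero.1 h0 with h2 | h2
  · exfalso
    have h3 : (Finset.univ.filter fun y : G ⧸ M => Subgroup.quotientMapOfLE h y =
        Subgroup.quotientMapOfLE h x).card = 0 := by exact_mod_cast h2
    rw [Finset.card_eq_zero] at h3
    have : x ∈ (∅ : Finset (G ⧸ M)) := by rw [← h3]; simp
    simp at this
  · exact h2

theorem cod_index_inf {G : Type} [Group G] (p : ℕ) (hp : p.Prime) (L₁ L₂ : Subgroup G)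
    (hn : L₁.Normal) (h₁ : ∃ a, L₁.index = p ^ a) (h₂ : ∃ a, L₂.index = p ^ a) :
    ∃ a, (L₁ ⊓ L₂).index = p ^ a := by
  obtain ⟨a, ha⟩ := h₁
  obtain ⟨b, hb⟩ := h₂
  have h1 := Subgroup.relIndex_mul_index (inf_le_right : L₁ ⊓ L₂ ≤ L₂)
  rw [Subgroup.inf_relIndex_right, hb] at h1
  have h2 := Subgroup.relIndex_dvd_index_of_normal L₁ L₂
  rw [ha, Nat.dvd_prime_pow hp] at h2
  obtain ⟨k, _, hk⟩ := h2
  exact ⟨k + b, by rw [← h1, hk, pow_add]⟩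

theorem cod_index_sInf {G : Type} [Group G] [Finite G] (p : ℕ) (hp : p.Prime)
    (s : Set (Subgroup G)) (hs : ∀ L ∈ s, L.Normal ∧ ∃ a, L.index = p ^ a) :
    ∃ a, (sInf s).index = p ^ a := by
  induction s, s.toFinite using Set.Finite.induction_on with
  | empty => exact ⟨0, by simp⟩
  | insert _ _ ih =>
    rw [sInf_insert]
    exact cod_index_inf p hp _ _ (hs _ (Set.mem_insert _ _)).1 (hs _ (Set.mem_insert _ _)).2
      (ih fun L hL => hs L (Set.mem_insert_of_mem _ hL))

theorem cod_step {G : Type} [Group G] [Fintype G] (p : ℕ) (hp : p.Prime)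
    (H : ∀ V : FDRep ℂ G, Simple V → ∃ n : ℕ, FDRep.codegree V = p ^ n)
    {M N : Subgroup G} (hM : M.Normal) (h : M ≤ N)
    (hmin : ∀ L : Subgroup G, L.Normal → M < L → N ≤ L) (hN : ∃ b, N.index = p ^ b) :
    ∃ a, M.index = p ^ a := by
  obtain ⟨b, hb⟩ := hN
  have hM0 : M.index ≠ 0 := Subgroup.index_ne_zero_of_finite
  obtain ⟨a, m, hm, hMm⟩ := Nat.exists_eq_pow_mul_and_not_dvd hM0 p hp.ne_one
  have hcop : ∀ n, Nat.Coprime m (p ^ n) := fun n =>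
    Nat.Coprime.pow_right _ ((Nat.Prime.coprime_iff_not_dvd hp).2 hm).symm
  have hdim : m ∣ finrank ℂ (codKerRep h).toSubmodule := by
    refine cod_dvd_finrank _ m _ fun S hSW hS => ?_
    have hsimp := cod_simple_of_irreducible _ (cod_irreducible_of_isAtom _ S hS)
    obtain ⟨n, hn⟩ := H _ hsimp
    have hd := cod_finrank_dvd_index _ hsimp
    have hk := cod_atom_ker hM h hmin S hSW hS
    have hmul := Nat.div_mul_cancel hd
    rw [FDRep.codegree] at hn
    rw [hn, hk] at hmul
    have : m ∣ p ^ n * finrank ℂ S.toSubmodule := by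
      refine Dvd.dvd.trans ⟨p ^ a, ?_⟩ (dvd_of_eq hmul.symm)
      rw [hMm, mul_comm]
    exact (hcop n).dvd_of_dvd_mul_left this
  have hr := finrank_codKerRep h
  have hmM : m ∣ M.index := ⟨p ^ a, by rw [hMm, mul_comm]⟩
  rw [← hr, Nat.dvd_add_left hdim, hb] at hmM
  have : m = 1 := Nat.eq_one_of_dvd_coprimes (hcop b) dvd_rfl hmM
  exact ⟨a, by rw [hMm, this, mul_one]⟩

theorem cod_index_normal {G : Type} [Group G] [Fintype G] (p : ℕ) (hp : p.Prime)
    (H : ∀ V : FDRep ℂ G, Simple V → ∃ n : ℕ, FDRep.codegree V = p ^ n)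
    (M : Subgroup G) (hM : M.Normal) : ∃ a, M.index = p ^ a := by
  induction M using WellFoundedGT.induction with
  | ind M ih =>
  have hN := cod_index_sInf p hp {L : Subgroup G | L.Normal ∧ M < L}
    fun L hL => ⟨hL.1, ih L hL.2 hL.1⟩
  exact cod_step p hp H hM (le_sInf fun L hL => hL.2.le)
    (fun L h1 h2 => sInf_le (show L ∈ {L : Subgroup G | L.Normal ∧ M < L} from ⟨h1, h2⟩)) hN

/-- For a nontrivial finite group `G` and a prime `p`, every irreducible complex character of
`G` has `p`-power codegree if and only if `G` is a `p`-group. -/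
theorem forall_codegree_pPower_iff_isPGroup
    (G : Type) [Group G] [Fintype G] [Nontrivial G] (p : ℕ) (hp : p.Prime) :
    (∀ V : FDRep ℂ G, Simple V → ∃ n : ℕ, FDRep.codegree V = p ^ n) ↔ IsPGroup p G := by
  constructor
  · intro H
    obtain ⟨a, ha⟩ := cod_index_normal p hp H ⊥ inferInstance
    rw [Subgroup.index_bot] at ha
    exact IsPGroup.of_card ha
  · intro hG V hV
    have : Fact p.Prime := ⟨hp⟩
    obtain ⟨k, hk⟩ := IsPGroup.iff_card.1 hG
    have h1 := cod_finrank_dvd_index V hV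
    have h2 : FDRep.codegree V ∣ p ^ k := by
      rw [← hk]
      exact (Nat.div_dvd_of_dvd h1).trans (Subgroup.index_dvd_card _)
    obtain ⟨n, _, hn⟩ := (Nat.dvd_prime_pow hp).1 h2
    exact ⟨n, hn⟩
end

section
/- Let G = C₃ × Q₈, the direct product of the cyclic group of order 3 with the quaternion group of order 8. Then G has a normal Sylow 3-subgroup, yet there exists a nonlinear, monomial, monolithic irreducible complex character χ of G such that cod(χ) is not a power of 3. -/
open CategoryTheory Module

open QuaternionGroup

/-- The group `C₃ × Q₈`. -/
abbrev GG : Type := Multiplicative (ZMod 3) × QuaternionGroup 2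

/-- The character `k ↦ i ^ k` of `ℤ / 4`. -/
noncomputable def ee : ZMod (2 * 2) → ℂ := fun k => Complex.I ^ k.val

lemma ee_add (i j : ZMod (2 * 2)) : ee (i + j) = ee i * ee j := by
  unfold ee
  rw [← pow_add, ZMod.val_add]
  exact (pow_eq_pow_mod _ Complex.I_pow_four).symm

lemma ee_zero : ee 0 = 1 := by simp [ee]

lemma ee_two : ee 2 = -1 := by
  have : (2 : ZMod (2 * 2)).val = 2 := rfl
  simp [ee, this]

lemma ee_neg_two : ee (-2) = -1 := by
  have : (-2 : ZMod (2 * 2)) = 2 := by decide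
  rw [this, ee_two]

/-- The two-dimensional matrix representation of `Q₈`. -/
noncomputable def mat : QuaternionGroup 2 → Matrix (Fin 2) (Fin 2) ℂ
  | a k => !![ee k, 0; 0, ee (-k)]
  | xa k => !![0, -ee (-k); ee k, 0]

lemma mat_one : mat 1 = 1 := by
  rw [one_def]
  simp [-Nat.reduceMul, mat, ee_zero, Matrix.one_fin_two]

lemma mat_mul (g h : QuaternionGroup 2) : mat (g * h) = mat g * mat h := by
  rcases g with i | i <;> rcases h with j | j
  · simp [-Nat.reduceMul, mat, ee_add, mul_comm]
  · simp [-Nat.reduceMul, mat, sub_eq_add_neg, ee_add, mul_comm]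
  · simp [-Nat.reduceMul, mat, ee_add, mul_comm]
  · simp [-Nat.reduceMul, mat, sub_eq_add_neg, ee_add, mul_comm, ee_two, ee_neg_two]

/-- The representation of `G`. -/
noncomputable def rho : Representation ℂ GG (Fin 2 → ℂ) where
  toFun g := Matrix.toLin' (mat g.2)
  map_one' := by simp [mat_one, Matrix.toLin'_one]; rfl
  map_mul' g h := by simp [mat_mul, Matrix.toLin'_mul]; rfl

/-- The module of the example. -/
noncomputable abbrev VV : FDRep ℂ GG := FDRep.of rho

lemma VV_char (g : GG) : VV.character g = (mat g.2).trace := by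
  change LinearMap.trace ℂ (Fin 2 → ℂ) (Matrix.toLin' (mat g.2)) = _
  exact Matrix.trace_toLin'_eq _

lemma VV_char_a (c) (k) : VV.character (c, a k) = ee k + ee (-k) := by
  rw [VV_char]; simp [-Nat.reduceMul, mat, Matrix.trace_fin_two]

lemma VV_char_xa (c) (k) : VV.character (c, xa k) = 0 := by
  rw [VV_char]; simp [-Nat.reduceMul, mat, Matrix.trace_fin_two]

lemma sum_q (f : QuaternionGroup 2 → ℂ) : ∑ q, f q = ∑ k, f (a k) + ∑ k, f (xa k) := by
  have h := Fintype.sum_sum_type (fun s => f (Sum.elim a xa s))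
  simp only [Sum.elim_inl, Sum.elim_inr] at h
  rw [← h]
  symm
  refine Fintype.sum_bijective (Sum.elim a xa) ⟨?_, ?_⟩ _ _ (fun _ => rfl)
  · rintro (i | i) (j | j) h <;> simp_all
  · rintro (i | i)
    · exact ⟨.inl i, rfl⟩
    · exact ⟨.inr i, rfl⟩

lemma card_G : Nat.card GG = 24 := by
  rw [Nat.card_prod, Nat.card_eq_fintype_card, Nat.card_eq_fintype_card, QuaternionGroup.card]
  rfl

lemma inv_a (k : ZMod (2 * 2)) : (a k : QuaternionGroup 2)⁻¹ = a (-k) := rfl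
lemma inv_xa (k : ZMod (2 * 2)) : (xa k : QuaternionGroup 2)⁻¹ = xa (2 + k) := rfl

lemma VV_simple : Simple VV := by
  rw [FDRep.simple_iff_char_is_norm_one, card_G, Fintype.sum_prod_type]
  simp only [sum_q, Prod.inv_mk, inv_a, inv_xa, VV_char_a, VV_char_xa]
  have h4 : ∀ f : ZMod (2 * 2) → ℂ, ∑ k, f k = f 0 + f 1 + f 2 + f 3 := fun f =>
    Fin.sum_univ_four f
  have h1 : (-1 : ZMod (2 * 2)) = 3 := by decide
  have h2 : (-2 : ZMod (2 * 2)) = 2 := by decide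
  have h3 : (-3 : ZMod (2 * 2)) = 1 := by decide
  have e1 : ee 1 = Complex.I := by
    have : (1 : ZMod (2 * 2)).val = 1 := rfl
    simp [ee, this]
  have e3 : ee 3 = - Complex.I := by
    have : (3 : ZMod (2 * 2)).val = 3 := rfl
    simp [ee, this, Complex.I_pow_three]
  simp [h4, h1, h2, h3, ee_zero, e1, e3, ee_two]
  norm_num

/-- The subgroup `C₃ × ⟨a⟩`. -/
def HH : Subgroup GG where
  carrier := {g | ∃ k, g.2 = a k}
  mul_mem' := by
    rintro ⟨c, g⟩ ⟨d, h⟩ ⟨k, hk⟩ ⟨l, hl⟩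
    refine ⟨k + l, ?_⟩
    simp only at hk hl
    simp [hk, hl]
  one_mem' := ⟨0, rfl⟩
  inv_mem' := by
    rintro ⟨c, g⟩ ⟨k, hk⟩
    refine ⟨-k, ?_⟩
    simp only at hk
    simp [hk, inv_a]

/-- The linear character `(c, a k) ↦ i ^ k`. -/
noncomputable def lam : HH →* ℂˣ := MonoidHom.toHomUnits
  { toFun := fun g => mat g.1.2 0 0
    map_one' := by simp [mat_one]
    map_mul' := by
      rintro ⟨⟨c, g⟩, k, hk⟩ ⟨⟨d, h⟩, l, hl⟩
      simp only at hk hl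
      simp [-Nat.reduceMul, hk, hl, mat, ee_add] }

lemma lam_apply (g : HH) : ((lam g : ℂˣ) : ℂ) = mat g.1.2 0 0 := rfl

lemma mem_HH_a (c) (k) : ((c, a k) : GG) ∈ HH := ⟨k, rfl⟩
lemma mem_HH_xa (c) (k) : ((c, xa k) : GG) ∉ HH := by
  rintro ⟨l, hl⟩
  simp at hl

lemma card_HH : Nat.card HH = 12 := by
  have e : (Multiplicative (ZMod 3) × ZMod (2 * 2)) ≃ HH := by
    refine Equiv.ofBijective (fun p => ⟨(p.1, a p.2), mem_HH_a _ _⟩) ⟨?_, ?_⟩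
    · rintro ⟨c, k⟩ ⟨d, l⟩ h
      simpa using h
    · rintro ⟨⟨c, g⟩, k, hk⟩
      simp only at hk
      subst hk
      exact ⟨(c, k), rfl⟩
  rw [← Nat.card_congr e, Nat.card_prod, Nat.card_eq_fintype_card, Nat.card_eq_fintype_card]
  rfl

lemma conj_a_a (c d) (k j) : ((d, a j) : GG)⁻¹ * (c, a k) * (d, a j) = (c, a k) := by
  ext1
  · simp
  · simp [inv_a]

lemma conj_xa_a (c d) (k j) : ((d, xa j) : GG)⁻¹ * (c, a k) * (d, xa j) = (c, a (-k)) := by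
  ext1
  · simp
  · revert k j; simp only [Prod.snd_mul, Prod.snd_inv]; decide

lemma conj_xa (c k) (x : GG) : x⁻¹ * (c, xa k) * x ∉ HH := by
  rcases x with ⟨d, j | j⟩
  · simp [inv_a, mem_HH_xa]
  · simp [inv_xa, mem_HH_xa]

lemma VV_monomial : IsMonomialChar VV.character := by
  refine ⟨HH, lam, ?_⟩
  funext ⟨c, g⟩
  unfold inducedLinearChar
  rw [card_HH]
  simp only [lam_apply]
  rcases g with k | k
  · rw [VV_char_a, Fintype.sum_prod_type]
    simp only [sum_q, conj_a_a, conj_xa_a, mem_HH_a, dif_pos, mat]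
    simp [ZMod.card]
    ring
  · rw [VV_char_xa]
    simp only [conj_xa, dif_neg, not_false_eq_true]
    simp

lemma mat_inj (g : QuaternionGroup 2) (h : mat g = 1) : g = 1 := by
  rcases g with k | k
  · have h00 := congrFun (congrFun h 0) 0
    simp [-Nat.reduceMul, mat, ee] at h00
    have : k = 0 ∨ k = 1 ∨ k = 2 ∨ k = 3 := by
      clear h h00
      revert k
      decide
    rcases this with rfl | rfl | rfl | rfl
    · rfl
    · have : (1 : ZMod (2 * 2)).val = 1 := rfl
      simp [this, Complex.ext_iff] at h00
    · have : (2 : ZMod (2 * 2)).val = 2 := rfl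
      norm_num [this, Complex.ext_iff] at h00
    · have : (3 : ZMod (2 * 2)).val = 3 := rfl
      simp [this, Complex.I_pow_three, Complex.ext_iff] at h00
  · have h00 := congrFun (congrFun h 0) 0
    simp [mat] at h00

lemma VV_ker : FDRep.charKer VV = (MonoidHom.snd (Multiplicative (ZMod 3)) (QuaternionGroup 2)).ker := by
  ext ⟨c, g⟩
  unfold FDRep.charKer
  rw [MonoidHom.mem_ker, MonoidHom.mem_ker, Units.ext_iff, Representation.asGroupHom_apply]
  change Matrix.toLin' (mat g) = LinearMap.id ↔ g = 1
  rw [← Matrix.toLin'_one, Matrix.toLin'.injective.eq_iff]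
  exact ⟨mat_inj g, fun h => h ▸ mat_one⟩

lemma VV_index : (FDRep.charKer VV).index = 8 := by
  rw [VV_ker, Subgroup.index_ker, MonoidHom.range_eq_top.2 Prod.snd_surjective,
    Subgroup.card_top, Nat.card_eq_fintype_card, QuaternionGroup.card]

lemma unique_min {H : Type*} [Group H] (z : H) (hz : z ≠ 1) (hc : ∀ g, g * z = z * g)
    (hp : ∀ g : H, g ≠ 1 → ∃ n : ℕ, g ^ n = z) : HasUniqueMinimalNormalSubgroup H := by
  have key : ∀ K : Subgroup H, K ≠ ⊥ → Subgroup.zpowers z ≤ K := by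
    intro K hK
    obtain ⟨⟨g, hg⟩, hg'⟩ := Subgroup.ne_bot_iff_exists_ne_one.1 hK
    have hg1 : g ≠ 1 := fun h => hg' (Subtype.ext h)
    obtain ⟨n, hn⟩ := hp _ hg1
    rw [Subgroup.zpowers_le, ← hn]
    exact K.pow_mem hg n
  have hnb : Subgroup.zpowers z ≠ ⊥ := by simpa using hz
  have hnorm : (Subgroup.zpowers z).Normal := by
    refine ⟨?_⟩
    rintro _ ⟨n, rfl⟩ g
    have : g * z ^ n * g⁻¹ = z ^ n := by
      rw [mul_inv_eq_iff_eq_mul]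
      exact (Commute.zpow_right (hc g) n)
    exact ⟨n, this.symm⟩
  refine ⟨Subgroup.zpowers z, ⟨hnorm, hnb, fun K _ hK hle => le_antisymm hle (key K hK)⟩, ?_⟩
  rintro N ⟨_, hN, hmin⟩
  exact (hmin _ hnorm hnb (key N hN)).symm

lemma mk_eq_one (g : GG) : (g : GG ⧸ FDRep.charKer VV) = 1 ↔ g.2 = 1 := by
  rw [QuotientGroup.eq_one_iff, VV_ker, MonoidHom.mem_ker]
  rfl

lemma VV_monolithic : HasUniqueMinimalNormalSubgroup (GG ⧸ FDRep.charKer VV) := by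
  refine unique_min (((1, a 2) : GG) : GG ⧸ FDRep.charKer VV) ?_ ?_ ?_
  · rw [Ne, mk_eq_one]
    decide
  · intro g
    obtain ⟨⟨c, g⟩, rfl⟩ := QuotientGroup.mk_surjective g
    rw [← QuotientGroup.mk_mul, ← QuotientGroup.mk_mul]
    congr 1
    ext1
    · simp
    · revert g; simp only [Prod.snd_mul]; decide
  · intro g hg
    obtain ⟨⟨c, g⟩, rfl⟩ := QuotientGroup.mk_surjective g
    rw [Ne, mk_eq_one] at hg
    have : ∀ g : QuaternionGroup 2, g ≠ 1 → g ^ 1 = a 2 ∨ g ^ 2 = a 2 := by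
      simp only [pow_succ, pow_zero]; decide
    have h2 : ∃ n : ℕ, g ^ n = a 2 := (this g hg).elim (fun h => ⟨1, h⟩) (fun h => ⟨2, h⟩)
    obtain ⟨n, hn⟩ := h2
    refine ⟨n, ?_⟩
    rw [← QuotientGroup.mk_pow, ← mul_inv_eq_one, ← QuotientGroup.mk_inv, ← QuotientGroup.mk_mul,
      mk_eq_one]
    simp [hn]

lemma VV_finrank : finrank ℂ VV = 2 := by
  change finrank ℂ (Fin 2 → ℂ) = 2
  simp

lemma sylow_part : ∃ P : Sylow 3 GG, (P : Subgroup GG).Normal := by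
  have : Fact (Nat.Prime 3) := ⟨Nat.prime_three⟩
  let K := (MonoidHom.snd (Multiplicative (ZMod 3)) (QuaternionGroup 2)).ker
  have hi : K.index = 8 := by rw [← VV_index, VV_ker]
  have hc := K.card_mul_index
  rw [hi, card_G] at hc
  have hf : (24 : ℕ).factorization 3 = 1 := by
    rw [show 24 = 8 * 3 ^ 1 by norm_num, Nat.factorization_mul (by norm_num) (by norm_num),
      Nat.Prime.factorization_pow Nat.prime_three]
    simp [Nat.factorization_eq_zero_of_not_dvd]
  refine ⟨Sylow.ofCard K ?_, ?_⟩
  · rw [card_G, hf, pow_one]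
    have h3 : Nat.card K = 3 := by omega
    exact h3
  · change K.Normal
    infer_instance

/-- `G = C₃ × Q₈` has a normal Sylow `3`-subgroup, yet it has a nonlinear, monomial,
monolithic irreducible complex character whose codegree is not a power of `3`. -/
theorem c3_times_q8_example :
    (∃ P : Sylow 3 (Multiplicative (ZMod 3) × QuaternionGroup 2),
      (P : Subgroup (Multiplicative (ZMod 3) × QuaternionGroup 2)).Normal) ∧
    (∃ V : FDRep ℂ (Multiplicative (ZMod 3) × QuaternionGroup 2), Simple V ∧
      1 < finrank ℂ V ∧
      IsMonomialChar V.character ∧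
      HasUniqueMinimalNormalSubgroup
        ((Multiplicative (ZMod 3) × QuaternionGroup 2) ⧸ FDRep.charKer V) ∧
      ¬ ∃ n : ℕ, FDRep.codegree V = 3 ^ n) := by
  refine ⟨sylow_part, VV, VV_simple, ?_, VV_monomial, VV_monolithic, ?_⟩
  · rw [VV_finrank]; norm_num
  · rintro ⟨n, hn⟩
    unfold FDRep.codegree at hn
    rw [VV_index, VV_finrank] at hn
    have h3 : Odd (3 ^ n) := Odd.pow (by decide)
    rw [← hn] at h3
    revert h3
    decide
end
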